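/- arXiv:math/0105181 — 2 statements merged into one kernel-verified Lean document; each statement's English description precedes it below -/
import Mathlib

section
/- The polynomial f = 4X³ + X² − 4 ∈ ℚ[X] is irreducible over ℚ, and its splitting field K over ℚ has degree 6 over ℚ; equivalently, the Galois group of f over ℚ is isomorphic to the symmetric group S₃. -/
/-!
The polynomial `f = 4X³ + X² − 4 ∈ ℚ[X]` (the two-division polynomial of the elliptic
curve `E₁ : y² + xy = x³ − 1` of conductor 431) is irreducible over ℚ, its splitting
field has degree 6 over ℚ, and its Galois group over ℚ is isomorphic to `S₃`.
-/

open Polynomial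

noncomputable section

/-- The two-division polynomial `4X³ + X² − 4` of `E₁ : y² + xy = x³ − 1`. -/
def f : ℚ[X] := 4 * X ^ 3 + X ^ 2 - 4

theorem f_natDegree : f.natDegree = 3 := by
  unfold f
  compute_degree!

theorem f_aeval {A : Type*} [CommRing A] [Algebra ℚ A] (x : A) :
    aeval x f = 4 * x ^ 3 + x ^ 2 - 4 := by
  simp [f, map_ofNat (aeval x) 4]

theorem f_irreducible : Irreducible f := by
  have f_ne_zero : f ≠ 0 := ne_zero_of_natDegree_gt (n := 0) (by simp [f_natDegree])
  rw [irreducible_iff_roots_eq_zero_of_degree_le_three (by simp [f_natDegree])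
    (by simp [f_natDegree]), Multiset.eq_zero_iff_forall_notMem]
  intro x hx
  have root_eq : 4 * x ^ 3 + x ^ 2 - 4 = 0 := by
    rw [← f_aeval x, coe_aeval_eq_eval]
    exact (mem_roots f_ne_zero).mp hx
  have integral : IsIntegral ℤ (4 * x) := by
    refine ⟨X ^ 3 + X ^ 2 - 64, by monicity!, ?_⟩
    simp only [eval₂_sub, eval₂_add, eval₂_X_pow, eval₂_ofNat]
    linear_combination 16 * root_eq
  obtain ⟨y, hy⟩ := IsIntegrallyClosed.isIntegral_iff.mp integral
  replace hy : (y : ℚ) = 4 * x := hy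
  have y_eq : y ^ 2 * (y + 1) = 64 := by
    have : (y : ℚ) ^ 2 * (y + 1) = 64 := by
      rw [hy]
      linear_combination 16 * root_eq
    exact_mod_cast this
  have y_nonneg : 0 ≤ y := by
    by_contra! h
    nlinarith [sq_nonneg y]
  rcases le_or_gt y 3 with h | h
  · interval_cases y <;> omega
  · nlinarith [mul_self_nonneg y]

theorem f_rootSet_real_subsingleton : (f.rootSet ℝ).Subsingleton := by
  have pos {x : ℝ} (hx : 4 * x ^ 3 + x ^ 2 - 4 = 0) : 0 < x := by
    by_contra! h
    nlinarith [mul_nonneg (neg_nonneg.mpr h) (sq_nonneg (x + 1)),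
      mul_nonneg (neg_nonneg.mpr h) (sq_nonneg x), sq_nonneg x, sq_nonneg (x + 1)]
  intro a ha b hb
  have ha' := (f_aeval a).symm.trans (mem_rootSet.mp ha).2
  have hb' := (f_aeval b).symm.trans (mem_rootSet.mp hb).2
  have a_pos := pos ha'
  have b_pos := pos hb'
  have factored : (a - b) * (4 * (a ^ 2 + a * b + b ^ 2) + (a + b)) = 0 := by
    linear_combination ha' - hb'
  have cofactor_ne_zero : 4 * (a ^ 2 + a * b + b ^ 2) + (a + b) ≠ 0 := by positivity
  exact sub_eq_zero.mp ((mul_eq_zero.mp factored).resolve_right cofactor_ne_zero)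

theorem f_card_rootSet_complex : Fintype.card (f.rootSet ℂ) = 3 := by
  rw [card_rootSet_eq_natDegree f_irreducible.separable (IsAlgClosed.splits _), f_natDegree]

theorem f_galActionHom_bijective : Function.Bijective
    (letI := Gal.splits_ℚ_ℂ (p := f); Gal.galActionHom f ℂ) := by
  have card_real : Fintype.card (f.rootSet ℝ) ≤ 1 :=
    Fintype.card_le_one_iff_subsingleton.mpr f_rootSet_real_subsingleton.coe_sort
  apply Gal.galActionHom_bijective_of_prime_degree' f_irreducible
  · rw [f_natDegree]
    exact Nat.prime_three
  · rw [f_card_rootSet_complex]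
    omega
  · rw [f_card_rootSet_complex]
    omega

/-- The Galois group of `f` is the full group of permutations of its three complex roots. -/
def fGalEquivPerm : f.Gal ≃* Equiv.Perm (Fin 3) :=
  (MulEquiv.ofBijective _ f_galActionHom_bijective).trans
    (Fintype.equivFinOfCardEq f_card_rootSet_complex).permCongrHom

theorem f_irreducible_splittingField_degree_six_gal_S3 :
    Irreducible f ∧
    Module.finrank ℚ f.SplittingField = 6 ∧
    Nonempty (f.Gal ≃* Equiv.Perm (Fin 3)) := by
  refine ⟨f_irreducible, ?_, ⟨fGalEquivPerm⟩⟩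
  rw [← Gal.card_of_separable f_irreducible.separable, Nat.card_congr fGalEquivPerm.toEquiv,
    Nat.card_perm, Nat.card_fin]
  rfl

end
end

section
/- The splitting field over ℚ of the polynomial f = 4X³ + X² − 4 is also a splitting field over ℚ of the polynomial g = 4X³ − 3X² − 34X − 31; that is, the splitting fields of f and g over ℚ coincide (are isomorphic as field extensions of ℚ). Consequently ℚ(E₁[2]) ≅ ℚ(E₂[2]). -/
/-!
The splitting field over ℚ of `f = 4X³ + X² − 4` (the two-division polynomial of
`E₁ : y² + xy = x³ − 1`) is also a splitting field over ℚ of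
`g = 4X³ − 3X² − 34X − 31` (the two-division polynomial of
`E₂ : y² + xy + y = x³ − x² − 9x − 8`); hence the two splitting fields coincide, i.e.
`ℚ(E₁[2]) ≅ ℚ(E₂[2])` as extensions of ℚ.
-/

open Polynomial

noncomputable section

/-- The two-division polynomial `4X³ − 3X² − 34X − 31` of
`E₂ : y² + xy + y = x³ − x² − 9x − 8`. -/
def g : ℚ[X] := 4 * X ^ 3 - 3 * X ^ 2 - 34 * X - 31

/-- The splitting field of a rational polynomial is a splitting field for any `ℚ`-algebra
structure on it, in particular for the one coming from characteristic zero. -/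
theorem isSplittingField_splittingField (p : ℚ[X]) [A : Algebra ℚ p.SplittingField] :
    IsSplittingField ℚ p.SplittingField p := by
  convert IsSplittingField.splittingField p
  exact Subsingleton.elim _ _

/-- If `x` is a root of `f`, then `7/4 x² + 31/16 x + 3/8` is a root of `g`. -/
theorem aeval_g_of_aeval_f {L : Type*} [Field L] [Algebra ℚ L] {x : L} (hx : aeval x f = 0) :
    aeval (7 / 4 * x ^ 2 + 31 / 16 * x + 3 / 8) g = 0 := by
  have : CharZero L := algebraRat.charZero L
  simp only [f, g, map_sub, map_add, map_mul, map_pow, aeval_X, map_ofNat] at hx ⊢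
  linear_combination 
    (5627 / 512 + 17143 / 1024 * x + 2107 / 128 * x ^ 2 + 343 / 64 * x ^ 3) * hx

/-- The map `y ↦ 7/4 y² - 57/16 y - 151/16` inverts `x ↦ 7/4 x² + 31/16 x + 3/8` on the roots
of `f`. -/
theorem eq_of_aeval_f {L : Type*} [Field L] [Algebra ℚ L] {x y : L} (hx : aeval x f = 0)
    (hy : y = 7 / 4 * x ^ 2 + 31 / 16 * x + 3 / 8) :
    x = 7 / 4 * y ^ 2 - 57 / 16 * y - 151 / 16 := by
  have : CharZero L := algebraRat.charZero L
  subst hy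
  simp only [f, map_sub, map_add, map_mul, map_pow, aeval_X, map_ofNat] at hx
  linear_combination (-2695 / 1024 - 343 / 256 * x) * hx

/-- The polynomial `g` splits over any extension of `ℚ` over which `f` splits. -/
theorem splits_g_of_splits_f {L : Type*} [Field L] [Algebra ℚ L]
    (hf : (f.map (algebraMap ℚ L)).Splits) : (g.map (algebraMap ℚ L)).Splits := by
  have : CharZero L := algebraRat.charZero L
  have hfc : f = (Cubic.mk 4 1 0 (-4) : Cubic ℚ).toPoly := by
    simp [f, Cubic.toPoly, sub_eq_add_neg, C_ofNat]
  have hgc : g = (Cubic.mk 4 (-3) (-34) (-31) : Cubic ℚ).toPoly := by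
    simp [g, Cubic.toPoly, sub_eq_add_neg, C_ofNat]
  rw [hfc] at hf
  have ha : (Cubic.mk 4 1 0 (-4) : Cubic ℚ).a ≠ 0 := by norm_num
  obtain ⟨x, y, z, h3⟩ := (Cubic.splits_iff_roots_eq_three ha).1 hf
  have hb := Cubic.b_eq_three_roots ha h3
  have hc := Cubic.c_eq_three_roots ha h3
  have hd := Cubic.d_eq_three_roots ha h3
  simp only [map_one, map_zero, map_neg, map_ofNat] at hb hc hd
  have e1 : x + y + z = -1 / 4 := by linear_combination hb / 4
  have e2 : x * y + x * z + y * z = 0 := by linear_combination -hc / 4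
  have e3 : x * y * z = 1 := by linear_combination hd / 4
  let p : L → L := fun t => 7 / 4 * t ^ 2 + 31 / 16 * t + 3 / 8
  have key : g.map (algebraMap ℚ L) =
      C 4 * (X - C (p x)) * (X - C (p y)) * (X - C (p z)) := by
    rw [hgc, ← Cubic.map_toPoly, Cubic.C_mul_prod_X_sub_C_eq]
    congr 1
    simp only [Cubic.map, map_neg, map_ofNat, Cubic.mk.injEq, true_and, p]
    refine ⟨?_, ?_, ?_⟩
    · grind
    · grind
    · grind
  rw [key]
  exact (((Splits.C 4).mul (Splits.X_sub_C _)).mul (Splits.X_sub_C _)).mul (Splits.X_sub_C _)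

/-- Every splitting field of `f` over `ℚ` is a splitting field of `g`. -/
theorem isSplittingField_g_of_isSplittingField_f (L : Type*) [Field L] [Algebra ℚ L]
    [IsSplittingField ℚ L f] : IsSplittingField ℚ L g := by
  refine ⟨splits_g_of_splits_f (IsSplittingField.splits L f), ?_⟩
  have hg : g ≠ 0 := fun h => by
    have := congrArg (eval 0) h
    simp [g] at this
  rw [eq_top_iff, ← IsSplittingField.adjoin_rootSet L f, Algebra.adjoin_le_iff]
  intro x hx
  have hx0 := (mem_rootSet'.1 hx).2
  have hy := Algebra.subset_adjoin (R := ℚ) (mem_rootSet.2 ⟨hg, aeval_g_of_aeval_f hx0⟩)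
  have hconst (a : ℚ) := (Algebra.adjoin ℚ (g.rootSet L)).algebraMap_mem a
  have h1 := hconst (7 / 4)
  have h2 := hconst (57 / 16)
  have h3 := hconst (151 / 16)
  simp only [map_div₀, map_ofNat] at h1 h2 h3
  rw [SetLike.mem_coe, eq_of_aeval_f hx0 rfl]
  exact sub_mem (sub_mem (mul_mem h1 (pow_mem hy 2)) (mul_mem h2 hy)) h3

theorem splittingField_f_eq_splittingField_g :
    IsSplittingField ℚ f.SplittingField g ∧
    Nonempty (f.SplittingField ≃ₐ[ℚ] g.SplittingField) := by
  have hf := isSplittingField_splittingField f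
  have hg := isSplittingField_splittingField g
  have h := isSplittingField_g_of_isSplittingField_f f.SplittingField
  exact ⟨h, ⟨(IsSplittingField.algEquiv f.SplittingField g).trans
    (IsSplittingField.algEquiv g.SplittingField g).symm⟩⟩

end
end
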